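/- Let u : ℝ → ℝ be a continuously differentiable 2π-periodic function with u(θ) > 0 for all θ. Then ( ∫_0^{2π} ( u'(θ)² − (1/4)·u(θ)² ) dθ ) · ( ∫_0^{2π} u(θ)^{−2} dθ ) ≥ −π², with equality if and only if u(θ) = c·√( λ²·cos²((θ−α)/2) + λ^{−2}·sin²((θ−α)/2) ) for some constants c > 0, λ > 0 and α ∈ [0, 2π). -/

import Mathlib

open Real MeasureTheory

open Filter Topology Set in
lemma continuousAt_div_mul_of_zero {f s c : ℝ → ℝ} {f' s' w : ℝ} (hf : HasDerivAt f f' w)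
    (hs : HasDerivAt s s' w) (hc : ContinuousAt c w) (hfw : f w = 0) (hsw : s w = 0)
    (hs' : s' ≠ 0) : ContinuousAt (fun x => c x / s x * f x ^ 2) w := by
  rw [continuousAt_iff_punctured_nhds]
  have h1 : Tendsto (fun x => slope f w x / slope s w x) (𝓝[≠] w) (𝓝 (f' / s')) :=
    (hasDerivAt_iff_tendsto_slope.mp hf).div (hasDerivAt_iff_tendsto_slope.mp hs) hs'
  have h2 : Tendsto (fun x => c x * f x * (slope f w x / slope s w x)) (𝓝[≠] w)
      (𝓝 (c w * f w * (f' / s'))) :=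
    ((hc.mul hf.continuousAt).tendsto.mono_left nhdsWithin_le_nhds).mul h1
  have h3 : c w / s w * f w ^ 2 = c w * f w * (f' / s') := by simp [hfw]
  rw [h3]
  refine h2.congr' ?_
  filter_upwards [self_mem_nhdsWithin] with x hx
  have hx' : x - w ≠ 0 := sub_ne_zero.mpr hx
  simp only [slope_def_field, hfw, hsw, sub_zero]
  rw [div_div_div_cancel_right₀ hx']
  ring

/-- Wirtinger's inequality with Dirichlet conditions on an interval of length `2π`, together with
its equality case. -/
lemma wirtinger_dirichlet {f f' : ℝ → ℝ} (hf : ∀ x, HasDerivAt f (f' x) x)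
    (hf' : Continuous f') {z : ℝ} (hz : f z = 0) (hz' : f (z + 2 * π) = 0) :
    0 ≤ (∫ x in z..(z + 2 * π), (f' x ^ 2 - 1 / 4 * f x ^ 2)) ∧
    ((∫ x in z..(z + 2 * π), (f' x ^ 2 - 1 / 4 * f x ^ 2)) = 0 →
      ∃ C : ℝ, ∀ x ∈ Set.Icc z (z + 2 * π), f x = C * sin ((x - z) / 2)) := by
  have hpi := Real.pi_pos
  have hfc : Continuous f := continuous_iff_continuousAt.mpr fun x => (hf x).continuousAt
  have hzle : z ≤ z + 2 * π := by linarith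
  set G : ℝ → ℝ := fun x => (1 / 2 * cos ((x - z) / 2)) / sin ((x - z) / 2) * f x ^ 2 with hG
  set E : ℝ → ℝ := fun x => f' x ^ 2 - 1 / 4 * f x ^ 2 with hE
  have hEc : Continuous E := by fun_prop
  set F : ℝ → ℝ := fun x => (∫ t in z..x, E t) - G x with hF
  have hhalf (x : ℝ) : HasDerivAt (fun x : ℝ => (x - z) / 2) (1 / 2) x :=
    ((hasDerivAt_id x).sub_const z).div_const 2
  have hsd (x : ℝ) : HasDerivAt (fun x => sin ((x - z) / 2)) (cos ((x - z) / 2) * (1 / 2)) x :=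
    (hhalf x).sin
  have hcd (x : ℝ) : HasDerivAt (fun x => cos ((x - z) / 2)) (-sin ((x - z) / 2) * (1 / 2)) x :=
    (hhalf x).cos
  have hspos {x : ℝ} (hx : x ∈ Set.Ioo z (z + 2 * π)) : 0 < sin ((x - z) / 2) :=
    Real.sin_pos_of_pos_of_lt_pi (by linarith [hx.1]) (by linarith [hx.2])
  have hID (x : ℝ) : HasDerivAt (fun x => ∫ t in z..x, E t) (E x) x :=
    hEc.integral_hasStrictDerivAt z x |>.hasDerivAt
  have hFd {x : ℝ} (hx : x ∈ Set.Ioo z (z + 2 * π)) : HasDerivAt F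
      ((f' x - (1 / 2 * cos ((x - z) / 2)) / sin ((x - z) / 2) * f x) ^ 2) x := by
    have hs := (hspos hx).ne'
    refine ((hID x).sub ((((hcd x).const_mul (1 / 2)).div (hsd x) hs).mul
      ((hf x).pow 2))).congr_deriv ?_
    simp only [hE, Pi.div_apply, Pi.pow_apply]
    field_simp
    push_cast
    ring
  have hGe {w : ℝ} (hw : f w = 0) (hs : sin ((w - z) / 2) = 0) : ContinuousAt G w := by
    refine continuousAt_div_mul_of_zero (hf w) (hsd w) (by fun_prop) hw hs ?_
    have hsc := Real.sin_sq_add_cos_sq ((w - z) / 2)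
    intro h
    have hc : cos ((w - z) / 2) = 0 := by linarith
    rw [hs, hc] at hsc
    norm_num at hsc
  have hFc : ContinuousOn F (Set.Icc z (z + 2 * π)) := by
    intro x hx
    rcases eq_or_lt_of_le hx.1 with h | h
    · subst h
      exact ((hID _).continuousAt.sub (hGe hz (by simp))).continuousWithinAt
    rcases eq_or_lt_of_le hx.2 with h' | h'
    · subst h'
      refine ((hID _).continuousAt.sub (hGe hz' ?_)).continuousWithinAt
      rw [show (z + 2 * π - z) / 2 = π by ring, Real.sin_pi]
    · exact (hFd ⟨h, h'⟩).continuousAt.continuousWithinAt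
  have hmono : MonotoneOn F (Set.Icc z (z + 2 * π)) := by
    refine monotoneOn_of_deriv_nonneg (convex_Icc _ _) hFc ?_ ?_
    · rw [interior_Icc]
      exact fun x hx => (hFd hx).differentiableAt.differentiableWithinAt
    · rw [interior_Icc]
      intro x hx
      rw [(hFd hx).deriv]
      positivity
  have hFz : F z = 0 := by simp [hF, hG, hz]
  have hFz' : F (z + 2 * π) = ∫ x in z..(z + 2 * π), E x := by simp [hF, hG, hz']
  have hlz : z ∈ Set.Icc z (z + 2 * π) := ⟨le_rfl, hzle⟩
  have hrz : z + 2 * π ∈ Set.Icc z (z + 2 * π) := ⟨hzle, le_rfl⟩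
  refine ⟨?_, fun h0 => ?_⟩
  · rw [← hFz', ← hFz]
    exact hmono hlz hrz hzle
  · have hF0 : ∀ x ∈ Set.Icc z (z + 2 * π), F x = 0 := fun x hx =>
      le_antisymm ((hmono hx hrz hx.2).trans (hFz'.trans h0).le)
        (hFz.symm.le.trans (hmono hlz hx hx.1))
    have hode : ∀ x ∈ Set.Ioo z (z + 2 * π),
        f' x = (1 / 2 * cos ((x - z) / 2)) / sin ((x - z) / 2) * f x := by
      intro x hx
      have hev : F =ᶠ[nhds x] fun _ => (0 : ℝ) := by
        filter_upwards [isOpen_Ioo.mem_nhds hx] with y hy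
        exact hF0 y (Set.Ioo_subset_Icc_self hy)
      have := (hFd hx).unique ((hasDerivAt_const x (0 : ℝ)).congr_of_eventuallyEq hev)
      exact sub_eq_zero.mp (pow_eq_zero_iff (two_ne_zero) |>.mp this)
    have hqd {x : ℝ} (hx : x ∈ Set.Ioo z (z + 2 * π)) :
        HasDerivAt (fun x => f x / sin ((x - z) / 2)) 0 x := by
      have hs := (hspos hx).ne'
      refine ((hf x).div (hsd x) hs).congr_deriv ?_
      rw [hode x hx]
      field_simp
      ring
    have hmid : z + π ∈ Set.Ioo z (z + 2 * π) := ⟨by linarith, by linarith⟩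
    refine ⟨f (z + π) / sin ((z + π - z) / 2), fun x hx => ?_⟩
    rcases eq_or_lt_of_le hx.1 with h | h
    · subst h
      simp [hz]
    rcases eq_or_lt_of_le hx.2 with h' | h'
    · subst h'
      rw [show (z + 2 * π - z) / 2 = π by ring, Real.sin_pi, hz', mul_zero]
    · have := isOpen_Ioo.is_const_of_deriv_eq_zero isPreconnected_Ioo
        (fun y hy => (hqd hy).differentiableAt.differentiableWithinAt)
        (fun y hy => (hqd hy).deriv) (⟨h, h'⟩ : x ∈ Set.Ioo z (z + 2 * π)) hmid
      rw [← this, div_mul_cancel₀ _ (hspos ⟨h, h'⟩).ne']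

/-- Wirtinger's inequality for antiperiodic functions, together with its equality case. -/
lemma wirtinger_antiperiodic {f f' : ℝ → ℝ} (hf : ∀ x, HasDerivAt f (f' x) x)
    (hf' : Continuous f') (ha : Function.Antiperiodic f (2 * π)) :
    0 ≤ (∫ x in (0 : ℝ)..(2 * π), (f' x ^ 2 - 1 / 4 * f x ^ 2)) ∧
    ((∫ x in (0 : ℝ)..(2 * π), (f' x ^ 2 - 1 / 4 * f x ^ 2)) = 0 →
      ∃ C z : ℝ, ∀ x, f x = C * sin ((x - z) / 2)) := by
  have hpi := Real.pi_pos
  have hfc : Continuous f := continuous_iff_continuousAt.mpr fun x => (hf x).continuousAt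
  have ha' : Function.Antiperiodic f' (2 * π) := by
    intro x
    have h1 : HasDerivAt (fun y => f (y + 2 * π)) (f' (x + 2 * π)) x :=
      (hf (x + 2 * π)).comp_add_const x (2 * π)
    rw [show (fun y => f (y + 2 * π)) = -f from funext ha] at h1
    exact h1.unique (hf x).neg
  obtain ⟨z, hz⟩ : ∃ z, f z = 0 := by
    refine mem_range_of_exists_le_of_exists_ge hfc ?_ ?_
    · rcases le_total (f 0) 0 with h | h
      · exact ⟨0, h⟩
      · exact ⟨0 + 2 * π, by rw [ha]; linarith⟩
    · rcases le_total 0 (f 0) with h | h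
      · exact ⟨0, h⟩
      · exact ⟨0 + 2 * π, by rw [ha]; linarith⟩
  have hper : Function.Periodic (fun x => f' x ^ 2 - 1 / 4 * f x ^ 2) (2 * π) := by
    intro x
    simp only [ha x, ha' x, neg_sq]
  have hI := hper.intervalIntegral_add_eq 0 z
  rw [zero_add] at hI
  rw [hI]
  obtain ⟨h1, h2⟩ := wirtinger_dirichlet hf hf' hz (by rw [ha, hz, neg_zero])
  refine ⟨h1, fun h0 => ?_⟩
  obtain ⟨C, hC⟩ := h2 h0
  refine ⟨C, z, fun x => ?_⟩
  have hd : Function.Periodic (fun x => (f x - C * sin ((x - z) / 2)) ^ 2) (2 * π) := by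
    intro x
    simp only
    rw [ha, show (x + 2 * π - z) / 2 = (x - z) / 2 + π by ring, Real.sin_add_pi]
    ring
  obtain ⟨y, hy, hxy⟩ := hd.exists_mem_Ico (by positivity) x z
  rw [hC y (Set.Ico_subset_Icc_self hy)] at hxy
  simp only [sub_self] at hxy
  exact sub_eq_zero.mp (pow_eq_zero_iff two_ne_zero |>.mp (hxy.trans (by norm_num)))

/-- A positive trigonometric polynomial of degree one is `c²(l²cos² + l⁻²sin²)` at half the
angle, up to a rotation. -/
lemma exists_eq_cos_sq_add_sin_sq {p q r : ℝ} (hpos : ∀ θ, 0 < p + q * cos θ + r * sin θ) :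
    ∃ c l a : ℝ, 0 < c ∧ 0 < l ∧ a ∈ Set.Ico (0 : ℝ) (2 * π) ∧
      ∀ θ, p + q * cos θ + r * sin θ =
        c ^ 2 * (l ^ 2 * cos ((θ - a) / 2) ^ 2 + (l ^ 2)⁻¹ * sin ((θ - a) / 2) ^ 2) := by
  obtain ⟨R, a, hR, ha, hq, hr⟩ : ∃ R a : ℝ, 0 ≤ R ∧ a ∈ Set.Ico (0 : ℝ) (2 * π) ∧
      q = R * cos a ∧ r = R * sin a := by
    let w : ℂ := ⟨q, r⟩
    refine ⟨‖w‖, toIcoMod Real.two_pi_pos 0 w.arg, norm_nonneg _, ?_, ?_, ?_⟩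
    · simpa using toIcoMod_mem_Ico Real.two_pi_pos 0 w.arg
    · rw [toIcoMod, zsmul_eq_mul, Real.cos_sub_int_mul_two_pi, Complex.norm_mul_cos_arg]
    · rw [toIcoMod, zsmul_eq_mul, Real.sin_sub_int_mul_two_pi, Complex.norm_mul_sin_arg]
  have hform (θ : ℝ) : p + q * cos θ + r * sin θ =
      (p + R) * cos ((θ - a) / 2) ^ 2 + (p - R) * sin ((θ - a) / 2) ^ 2 := by
    have h1 : cos (θ - a) = 2 * cos ((θ - a) / 2) ^ 2 - 1 := by
      rw [← Real.cos_two_mul]; congr 1; ring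
    have h2 := Real.sin_sq_add_cos_sq ((θ - a) / 2)
    rw [Real.cos_sub] at h1
    rw [hq, hr]
    linear_combination R * h1 + (R - p) * h2
  have hm : 0 < p - R := by
    have h := hpos (a + π)
    rw [hform, show (a + π - a) / 2 = π / 2 by ring] at h
    simpa using h
  have hp : 0 < p + R := by linarith
  obtain ⟨A, hA0, hA2⟩ : ∃ A : ℝ, 0 < A ∧ A ^ 2 = p + R :=
    ⟨√(p + R), Real.sqrt_pos.mpr hp, Real.sq_sqrt hp.le⟩
  obtain ⟨B, hB0, hB2⟩ : ∃ B : ℝ, 0 < B ∧ B ^ 2 = p - R :=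
    ⟨√(p - R), Real.sqrt_pos.mpr hm, Real.sq_sqrt hm.le⟩
  refine ⟨√(A * B), √(A / B), a, by positivity, by positivity, ha, fun θ => ?_⟩
  rw [hform, ← hA2, ← hB2, Real.sq_sqrt (by positivity), Real.sq_sqrt (by positivity)]
  field_simp

lemma cos_sq_add_sin_sq_pos (t : ℝ) {A B : ℝ} (hA : 0 < A) (hB : 0 < B) :
    0 < A * cos t ^ 2 + B * sin t ^ 2 := by
  have h := Real.sin_sq_add_cos_sq t
  rcases eq_or_ne (cos t) 0 with hc | hc
  · have : sin t ≠ 0 := by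
      intro hs
      rw [hs, hc] at h
      norm_num at h
    positivity
  · positivity

/-- `∫ dθ / (l²cos² + l⁻²sin²) = 2π` at half the angle, over one period. The primitive used is
`2 arg (l cos + i l⁻¹ sin)`, in a form that is smooth on the whole line. -/
lemma integral_inv_cos_sq_add_sin_sq {l : ℝ} (hl : 0 < l) (a : ℝ) :
    ∫ θ in (0 : ℝ)..(2 * π),
      (l ^ 2 * cos ((θ - a) / 2) ^ 2 + (l ^ 2)⁻¹ * sin ((θ - a) / 2) ^ 2)⁻¹ = 2 * π := by
  have hhalf (x : ℝ) : HasDerivAt (fun x : ℝ => (x - a) / 2) (1 / 2) x :=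
    ((hasDerivAt_id x).sub_const a).div_const 2
  have hM (t : ℝ) : 0 < l ^ 2 * cos t ^ 2 + (l ^ 2)⁻¹ * sin t ^ 2 :=
    cos_sq_add_sin_sq_pos t (by positivity) (by positivity)
  have hD (t : ℝ) : 0 < l ^ 2 * cos t ^ 2 + sin t ^ 2 :=
    one_mul (sin t ^ 2) ▸ cos_sq_add_sin_sq_pos t (by positivity) one_pos
  let Q : ℝ → ℝ := fun t =>
    2 * arctan ((1 - l ^ 2) * (sin t * cos t) / (l ^ 2 * cos t ^ 2 + sin t ^ 2))
  have hQ (t : ℝ) : HasDerivAt (fun t => 2 * t + Q t)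
      (2 * (l ^ 2 * cos t ^ 2 + (l ^ 2)⁻¹ * sin t ^ 2)⁻¹) t := by
    have hN : HasDerivAt (fun t => (1 - l ^ 2) * (sin t * cos t))
        ((1 - l ^ 2) * (cos t * cos t + sin t * -sin t)) t :=
      (((hasDerivAt_sin t).mul (hasDerivAt_cos t)).const_mul (1 - l ^ 2))
    have hDd : HasDerivAt (fun t => l ^ 2 * cos t ^ 2 + sin t ^ 2)
        (l ^ 2 * (2 * cos t * -sin t) + 2 * sin t * cos t) t := by
      have := (((hasDerivAt_cos t).fun_pow 2).const_mul (l ^ 2)).fun_add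
        ((hasDerivAt_sin t).fun_pow 2)
      simpa using this
    refine (((hasDerivAt_id t).const_mul 2).add
      ((hN.div hDd (hD t).ne').arctan.const_mul 2)).congr_deriv ?_
    have h1 := (hM t).ne'
    have h2 := (hD t).ne'
    have hsc := Real.sin_sq_add_cos_sq t
    have hsum : 1 + ((1 - l ^ 2) * (sin t * cos t) / (l ^ 2 * cos t ^ 2 + sin t ^ 2)) ^ 2 =
        l ^ 2 * (l ^ 2 * cos t ^ 2 + (l ^ 2)⁻¹ * sin t ^ 2) /
          (l ^ 2 * cos t ^ 2 + sin t ^ 2) ^ 2 := by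
      field_simp
      linear_combination (l ^ 4 * cos t ^ 2 + sin t ^ 2) * hsc
    rw [Pi.div_apply, hsum]
    have hkey : l ^ 2 * (l ^ 2 * cos t ^ 2 + (l ^ 2)⁻¹ * sin t ^ 2) =
        l ^ 4 * cos t ^ 2 + sin t ^ 2 := by
      field_simp
    have h3 : l ^ 4 * cos t ^ 2 + sin t ^ 2 ≠ 0 := hkey ▸ (by positivity)
    have h4 : (l ^ 2 * cos t ^ 2 + (l ^ 2)⁻¹ * sin t ^ 2)⁻¹ =
        l ^ 2 / (l ^ 4 * cos t ^ 2 + sin t ^ 2) := by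
      rw [← hkey]
      field_simp
    rw [h4, hkey]
    field_simp
    linear_combination ((1 - l ^ 2) * (l ^ 2 * cos t ^ 2 - sin t ^ 2) + l ^ 2) * hsc
  have hF (x : ℝ) : HasDerivAt (fun x => 2 * ((x - a) / 2) + Q ((x - a) / 2))
      ((l ^ 2 * cos ((x - a) / 2) ^ 2 + (l ^ 2)⁻¹ * sin ((x - a) / 2) ^ 2)⁻¹) x :=
    ((hQ _).comp x (hhalf x)).congr_deriv (by ring)
  rw [intervalIntegral.integral_eq_sub_of_hasDerivAt (fun x _ => hF x)]
  · rw [show (2 * π - a) / 2 = (0 - a) / 2 + π by ring]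
    simp only [Q, Real.sin_add_pi, Real.cos_add_pi, neg_mul_neg, neg_sq]
    ring
  · refine Continuous.intervalIntegrable (Continuous.inv₀ (by fun_prop) fun x => (hM _).ne') _ _

/-- The equality case of the sharp inequality: the extremal functions attain `-π²`. -/
lemma sobolev_circle_eq_of_extremal {u u' : ℝ → ℝ} (hu : ∀ x, HasDerivAt u (u' x) x)
    {c l a : ℝ} (hc : 0 < c) (hl : 0 < l)
    (h : ∀ θ, u θ = c * √(l ^ 2 * cos ((θ - a) / 2) ^ 2 + (l ^ 2)⁻¹ * sin ((θ - a) / 2) ^ 2)) :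
    ((∫ θ in (0 : ℝ)..(2 * π), (u' θ ^ 2 - 1 / 4 * u θ ^ 2)) *
      ∫ θ in (0 : ℝ)..(2 * π), (u θ ^ 2)⁻¹) = -π ^ 2 := by
  have hM (t : ℝ) : 0 < l ^ 2 * cos t ^ 2 + (l ^ 2)⁻¹ * sin t ^ 2 :=
    cos_sq_add_sin_sq_pos t (by positivity) (by positivity)
  have hupos (θ : ℝ) : 0 < u θ := by
    rw [h]
    exact mul_pos hc (Real.sqrt_pos.mpr (hM _))
  have hu2 (θ : ℝ) : u θ ^ 2 =
      c ^ 2 * (l ^ 2 * cos ((θ - a) / 2) ^ 2 + (l ^ 2)⁻¹ * sin ((θ - a) / 2) ^ 2) := by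
    rw [h, mul_pow, Real.sq_sqrt (hM _).le]
  have hL : ∫ θ in (0 : ℝ)..(2 * π), (u θ ^ 2)⁻¹ = (c ^ 2)⁻¹ * (2 * π) := by
    simp_rw [hu2, mul_inv (c ^ 2)]
    rw [intervalIntegral.integral_const_mul, integral_inv_cos_sq_add_sin_sq hl]
  have hhalf (x : ℝ) : HasDerivAt (fun x : ℝ => (x - a) / 2) (1 / 2) x :=
    ((hasDerivAt_id x).sub_const a).div_const 2
  obtain ⟨m, hm⟩ : ∃ m, m = c ^ 2 * ((l ^ 2)⁻¹ - l ^ 2) / 2 := ⟨_, rfl⟩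
  have hder (x : ℝ) : u x * u' x = m * (sin ((x - a) / 2) * cos ((x - a) / 2)) := by
    have h1 : HasDerivAt (fun x => u x ^ 2) (2 * u x * u' x) x := by
      simpa using (hu x).fun_pow 2
    have h2 : HasDerivAt (fun x => u x ^ 2) (c ^ 2 *
        (l ^ 2 * (2 * cos ((x - a) / 2) * (-sin ((x - a) / 2) * (1 / 2))) +
        (l ^ 2)⁻¹ * (2 * sin ((x - a) / 2) * (cos ((x - a) / 2) * (1 / 2))))) x := by
      rw [funext hu2]
      have := ((((hhalf x).cos.fun_pow 2).const_mul (l ^ 2)).fun_add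
        (((hhalf x).sin.fun_pow 2).const_mul (l ^ 2)⁻¹)).const_mul (c ^ 2)
      simpa using this
    rw [hm]
    linear_combination (1 / 2) * h1.unique h2
  have hE (x : ℝ) : u' x ^ 2 - 1 / 4 * u x ^ 2 =
      m / 2 * cos (x - a) - c ^ 4 / 4 * (u x ^ 2)⁻¹ := by
    have hx := (hupos x).ne'
    have h1 : cos (x - a) = 2 * cos ((x - a) / 2) ^ 2 - 1 := by
      rw [← Real.cos_two_mul]
      congr 1
      ring
    have h2 : u x ^ 2 * (u' x ^ 2 - 1 / 4 * u x ^ 2) =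
        u x ^ 2 * (m / 2 * cos (x - a)) - c ^ 4 / 4 := by
      rw [mul_sub, ← mul_pow, hder, hu2, h1, hm]
      have hs := Real.sin_sq ((x - a) / 2)
      have hl' := hl.ne'
      rw [mul_pow, mul_pow, hs]
      field_simp
      ring
    field_simp
    linear_combination 8 * h2
  have huc : Continuous u := continuous_iff_continuousAt.mpr fun x => (hu x).continuousAt
  have hcos : ∫ θ in (0 : ℝ)..(2 * π), cos (θ - a) = 0 := by
    rw [intervalIntegral.integral_comp_sub_right (fun x => cos x), integral_cos,
      show 2 * π - a = 0 - a + 2 * π by ring, Real.sin_add_two_pi, sub_self]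
  have hI : ∫ θ in (0 : ℝ)..(2 * π), (u' θ ^ 2 - 1 / 4 * u θ ^ 2) =
      -(c ^ 4 / 4 * ((c ^ 2)⁻¹ * (2 * π))) := by
    simp_rw [hE]
    rw [intervalIntegral.integral_sub, intervalIntegral.integral_const_mul,
      intervalIntegral.integral_const_mul, hcos, hL]
    · ring
    · exact Continuous.intervalIntegrable (by fun_prop) _ _
    · exact ((huc.pow 2).inv₀ fun x => (pow_pos (hupos x) 2).ne').const_mul _
        |>.intervalIntegrable _ _
  rw [hI, hL]
  field_simp
  ring

/-- Sharp Sobolev-type inequality on the circle: for a positive C¹, 2π-periodic u,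
`(∫ (u'² − ¼u²))·(∫ u⁻²) ≥ −π²`, with equality iff
`u(θ) = c√(λ²cos²((θ−α)/2) + λ⁻²sin²((θ−α)/2))`. -/
theorem sharp_sobolev_circle
    (u : ℝ → ℝ)
    (hu : ContDiff ℝ 1 u)
    (huper : ∀ θ, u (θ + 2 * π) = u θ)
    (hupos : ∀ θ, 0 < u θ) :
    ((∫ θ in (0:ℝ)..(2 * π), ((deriv u θ) ^ 2 - (1 / 4) * (u θ) ^ 2)) *
        ∫ θ in (0:ℝ)..(2 * π), ((u θ) ^ 2)⁻¹) ≥ -(π ^ 2)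
    ∧ (((∫ θ in (0:ℝ)..(2 * π), ((deriv u θ) ^ 2 - (1 / 4) * (u θ) ^ 2)) *
          ∫ θ in (0:ℝ)..(2 * π), ((u θ) ^ 2)⁻¹) = -(π ^ 2)
        ↔ ∃ (c l a : ℝ), 0 < c ∧ 0 < l ∧ a ∈ Set.Ico (0:ℝ) (2 * π) ∧
            ∀ θ, u θ = c * Real.sqrt
              (l ^ 2 * (Real.cos ((θ - a) / 2)) ^ 2
                + (l ^ 2)⁻¹ * (Real.sin ((θ - a) / 2)) ^ 2)) := by
  have hpi := Real.pi_pos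
  have hud (x : ℝ) : HasDerivAt u (deriv u x) x :=
    (hu.differentiable one_ne_zero x).hasDerivAt
  have hv : Continuous (deriv u) := hu.continuous_deriv le_rfl
  have huc : Continuous u := hu.continuous
  have hne (x : ℝ) : u x ≠ 0 := (hupos x).ne'
  generalize deriv u = v at *
  have hwc : Continuous fun x => (u x ^ 2)⁻¹ := (huc.pow 2).inv₀ fun x => pow_ne_zero 2 (hne x)
  have hwper : Function.Periodic (fun x => (u x ^ 2)⁻¹) (2 * π) := fun x => by
    simp only [huper]
  set L := ∫ θ in (0 : ℝ)..(2 * π), (u θ ^ 2)⁻¹ with hL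
  have hLpos : 0 < L := intervalIntegral.intervalIntegral_pos_of_pos
    (hwc.intervalIntegrable _ _) (fun x => inv_pos.mpr (pow_pos (hupos x) 2)) (by positivity)
  set I := ∫ θ in (0 : ℝ)..(2 * π), (v θ ^ 2 - 1 / 4 * u θ ^ 2) with hI
  -- The curve `u · exp(iφ)`, with phase `φ` proportional to `∫ u⁻²`, is `2π`-antiperiodic.
  let φ : ℝ → ℝ := fun x => π / L * ∫ t in (0 : ℝ)..x, (u t ^ 2)⁻¹
  have hφd (x : ℝ) : HasDerivAt φ (π / L * (u x ^ 2)⁻¹) x :=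
    (hwc.integral_hasStrictDerivAt 0 x).hasDerivAt.const_mul _
  have hφc : Continuous φ := continuous_iff_continuousAt.mpr fun x => (hφd x).continuousAt
  have hφper (x : ℝ) : φ (x + 2 * π) = φ x + π := by
    have h1 := intervalIntegral.integral_add_adjacent_intervals
      (hwc.intervalIntegrable 0 x) (hwc.intervalIntegrable x (x + 2 * π)) (μ := volume)
    have h2 := hwper.intervalIntegral_add_eq x 0
    rw [zero_add, ← hL] at h2
    simp only [φ]
    rw [← h1, h2, mul_add, div_mul_cancel₀ _ hLpos.ne']
  let X' : ℝ → ℝ := fun x => v x * cos (φ x) + u x * (-sin (φ x) * (π / L * (u x ^ 2)⁻¹))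
  let Y' : ℝ → ℝ := fun x => v x * sin (φ x) + u x * (cos (φ x) * (π / L * (u x ^ 2)⁻¹))
  have hXd (x : ℝ) : HasDerivAt (fun x => u x * cos (φ x)) (X' x) x := (hud x).mul (hφd x).cos
  have hYd (x : ℝ) : HasDerivAt (fun x => u x * sin (φ x)) (Y' x) x := (hud x).mul (hφd x).sin
  have hXc : Continuous X' := by fun_prop
  have hYc : Continuous Y' := by fun_prop
  have hXa : Function.Antiperiodic (fun x => u x * cos (φ x)) (2 * π) := fun x => by
    simp only [huper, hφper, Real.cos_add_pi, mul_neg]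
  have hYa : Function.Antiperiodic (fun x => u x * sin (φ x)) (2 * π) := fun x => by
    simp only [huper, hφper, Real.sin_add_pi, mul_neg]
  obtain ⟨hX0, hXeq⟩ := wirtinger_antiperiodic hXd hXc hXa
  obtain ⟨hY0, hYeq⟩ := wirtinger_antiperiodic hYd hYc hYa
  have hsum : (∫ x in (0 : ℝ)..(2 * π), (X' x ^ 2 - 1 / 4 * (u x * cos (φ x)) ^ 2)) +
      (∫ x in (0 : ℝ)..(2 * π), (Y' x ^ 2 - 1 / 4 * (u x * sin (φ x)) ^ 2)) =
      I + π ^ 2 / L := by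
    have hpt (x : ℝ) : (X' x ^ 2 - 1 / 4 * (u x * cos (φ x)) ^ 2) +
        (Y' x ^ 2 - 1 / 4 * (u x * sin (φ x)) ^ 2) =
        (v x ^ 2 - 1 / 4 * u x ^ 2) + (π / L) ^ 2 * (u x ^ 2)⁻¹ := by
      have hx := hne x
      simp only [X', Y']
      field_simp
      linear_combination (4 * v x ^ 2 * u x ^ 2 * L ^ 2 + 4 * π ^ 2 - u x ^ 4 * L ^ 2) *
        Real.sin_sq_add_cos_sq (φ x)
    rw [← intervalIntegral.integral_add (Continuous.intervalIntegrable (by fun_prop) _ _)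
      (Continuous.intervalIntegrable (by fun_prop) _ _)]
    simp_rw [hpt]
    rw [intervalIntegral.integral_add (Continuous.intervalIntegrable (by fun_prop) _ _)
      (Continuous.intervalIntegrable (by fun_prop) _ _), intervalIntegral.integral_const_mul,
      ← hL, ← hI]
    field_simp
  have hIL : I * L + π ^ 2 = (I + π ^ 2 / L) * L := by field_simp
  refine ⟨?_, fun heq => ?_, ?_⟩
  · have : 0 ≤ (I + π ^ 2 / L) * L := mul_nonneg (by linarith) hLpos.le
    linarith
  · have hz : I + π ^ 2 / L = 0 := by
      have : (I + π ^ 2 / L) * L = 0 := by linarith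
      exact (mul_eq_zero.mp this).resolve_right hLpos.ne'
    obtain ⟨C, z, hC⟩ := hXeq (by linarith)
    obtain ⟨D, w, hD⟩ := hYeq (by linarith)
    have hu2 (θ : ℝ) : u θ ^ 2 = (C ^ 2 + D ^ 2) / 2 +
        (-(C ^ 2 * cos z + D ^ 2 * cos w) / 2) * cos θ +
        (-(C ^ 2 * sin z + D ^ 2 * sin w) / 2) * sin θ := by
      have h1 : u θ ^ 2 = (u θ * cos (φ θ)) ^ 2 + (u θ * sin (φ θ)) ^ 2 := by
        linear_combination -u θ ^ 2 * Real.sin_sq_add_cos_sq (φ θ)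
      have hhalf (b : ℝ) : sin ((θ - b) / 2) ^ 2 =
          (1 - (cos θ * cos b + sin θ * sin b)) / 2 := by
        rw [← Real.cos_sub, Real.sin_sq_eq_half_sub, show 2 * ((θ - b) / 2) = θ - b by ring]
        ring
      rw [h1, hC, hD, mul_pow, mul_pow, hhalf, hhalf]
      ring
    obtain ⟨c, l, a, hc, hl, ha, h⟩ := exists_eq_cos_sq_add_sin_sq
      (fun θ => hu2 θ ▸ pow_pos (hupos θ) 2)
    refine ⟨c, l, a, hc, hl, ha, fun θ => ?_⟩
    rw [← Real.sqrt_sq (hupos θ).le, hu2, h, Real.sqrt_mul (by positivity), Real.sqrt_sq hc.le]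
  · rintro ⟨c, l, a, hc, hl, -, h⟩
    exact sobolev_circle_eq_of_extremal hud hc hl h
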